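/- arXiv:1210.0782 — 2 statements merged into one kernel-verified Lean document; each statement's English description precedes it below -/
import Mathlib

section
/- Let m ≥ 2, let f : ℝ → ℝ be continuous, let 0 < a < b, and let U : (a,b) × (0, π/2) → ℝ be twice continuously differentiable and satisfy U_rr + ((2m−1)/r)·U_r + ((m−1)/r²)·(cos θ/sin θ − sin θ/cos θ)·U_θ + (1/r²)·U_θθ + f(U) = 0 for all (r,θ) ∈ (a,b) × (0,π/2). Define V(ρ,φ) := U(√(2ρ), φ/2) for ρ ∈ (a²/2, b²/2) and φ ∈ (0,π). Then V satisfies V_ρρ + (m/ρ)·V_ρ + ((m−1)/ρ²)·(cos φ/sin φ)·V_φ + (1/ρ²)·V_φφ + f(V)/(2ρ) = 0 for all (ρ,φ) ∈ (a²/2, b²/2) × (0,π). -/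
noncomputable section
open Real

/-- First partial derivative of a function of two real variables. -/
def pd1 (U : ℝ × ℝ → ℝ) (q : ℝ × ℝ) : ℝ := fderiv ℝ U q (1, 0)

/-- Second partial derivative of a function of two real variables. -/
def pd2 (U : ℝ × ℝ → ℝ) (q : ℝ × ℝ) : ℝ := fderiv ℝ U q (0, 1)

lemma comp_hasFDerivAt (G : ℝ × ℝ → ℝ) (q : ℝ × ℝ) (hq : 0 < q.1)
    (hG : DifferentiableAt ℝ G (Real.sqrt (2 * q.1), q.2 / 2)) :
    HasFDerivAt (fun q : ℝ × ℝ => G (Real.sqrt (2 * q.1), q.2 / 2))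
      ((fderiv ℝ G (Real.sqrt (2 * q.1), q.2 / 2)).comp
        (((1 / Real.sqrt (2 * q.1)) • ContinuousLinearMap.fst ℝ ℝ ℝ).prod
          ((1 / 2 : ℝ) • ContinuousLinearMap.snd ℝ ℝ ℝ))) q := by
  have h1 : HasFDerivAt (fun q : ℝ × ℝ => Real.sqrt (2 * q.1))
      ((1 / Real.sqrt (2 * q.1)) • ContinuousLinearMap.fst ℝ ℝ ℝ) q := by
    have h := ((hasFDerivAt_fst (𝕜 := ℝ) (p := q)).const_mul (2 : ℝ)).sqrt (by positivity)
    have hs : Real.sqrt (2 * q.1) ≠ 0 := by positivity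
    have he : 1 / (2 * Real.sqrt (2 * q.1)) * 2 = 1 / Real.sqrt (2 * q.1) := by field_simp
    rw [smul_smul, he] at h
    exact h
  have h2 : HasFDerivAt (fun q : ℝ × ℝ => q.2 / 2)
      ((1 / 2 : ℝ) • ContinuousLinearMap.snd ℝ ℝ ℝ) q := by
    have h := (hasFDerivAt_snd (𝕜 := ℝ) (p := q)).const_mul (1 / 2 : ℝ)
    refine h.congr_of_eventuallyEq (Filter.Eventually.of_forall fun x => ?_)
    simp only
    ring
  exact HasFDerivAt.comp (g := G) (f := fun q : ℝ × ℝ => (Real.sqrt (2 * q.1), q.2 / 2)) q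
    hG.hasFDerivAt (h1.prodMk h2)

lemma pd1_comp (G : ℝ × ℝ → ℝ) (q : ℝ × ℝ) (hq : 0 < q.1)
    (hG : DifferentiableAt ℝ G (Real.sqrt (2 * q.1), q.2 / 2)) :
    pd1 (fun q : ℝ × ℝ => G (Real.sqrt (2 * q.1), q.2 / 2)) q =
      (1 / Real.sqrt (2 * q.1)) * pd1 G (Real.sqrt (2 * q.1), q.2 / 2) := by
  unfold pd1
  rw [(comp_hasFDerivAt G q hq hG).fderiv]
  have h := (fderiv ℝ G (Real.sqrt (2 * q.1), q.2 / 2)).map_smul (1 / Real.sqrt (2 * q.1) : ℝ) ((1, 0) : ℝ × ℝ)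
  rw [smul_eq_mul] at h
  rw [← h]
  simp

lemma pd2_comp (G : ℝ × ℝ → ℝ) (q : ℝ × ℝ) (hq : 0 < q.1)
    (hG : DifferentiableAt ℝ G (Real.sqrt (2 * q.1), q.2 / 2)) :
    pd2 (fun q : ℝ × ℝ => G (Real.sqrt (2 * q.1), q.2 / 2)) q =
      (1 / 2) * pd2 G (Real.sqrt (2 * q.1), q.2 / 2) := by
  unfold pd2
  rw [(comp_hasFDerivAt G q hq hG).fderiv]
  have h := (fderiv ℝ G (Real.sqrt (2 * q.1), q.2 / 2)).map_smul (1 / 2 : ℝ) ((0, 1) : ℝ × ℝ)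
  rw [smul_eq_mul] at h
  rw [← h]
  simp

/-- if `U` is twice continuously differentiable on `(a,b) × (0,π/2)` and satisfies
`U_rr + ((2m−1)/r)·U_r + ((m−1)/r²)·(cos θ/sin θ − sin θ/cos θ)·U_θ + (1/r²)·U_θθ + f(U) = 0`
there, then `V(ρ,φ) := U(√(2ρ), φ/2)` satisfies
`V_ρρ + (m/ρ)·V_ρ + ((m−1)/ρ²)·(cos φ/sin φ)·V_φ + (1/ρ²)·V_φφ + f(V)/(2ρ) = 0`
on `(a²/2, b²/2) × (0,π)`. -/
theorem stmt_4 (m : ℕ) (hm : 2 ≤ m) (f : ℝ → ℝ) (hf : Continuous f)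
    (a b : ℝ) (ha : 0 < a) (hab : a < b) (U : ℝ × ℝ → ℝ)
    (hU : ContDiffOn ℝ 2 U (Set.Ioo a b ×ˢ Set.Ioo 0 (π / 2)))
    (hEq : ∀ r θ : ℝ, r ∈ Set.Ioo a b → θ ∈ Set.Ioo 0 (π / 2) →
      pd1 (pd1 U) (r, θ) + ((2 * (m : ℝ) - 1) / r) * pd1 U (r, θ) +
        (((m : ℝ) - 1) / r ^ 2) *
          (Real.cos θ / Real.sin θ - Real.sin θ / Real.cos θ) * pd2 U (r, θ) +
        (1 / r ^ 2) * pd2 (pd2 U) (r, θ) + f (U (r, θ)) = 0) :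
    ∀ V : ℝ × ℝ → ℝ, V = (fun q : ℝ × ℝ => U (Real.sqrt (2 * q.1), q.2 / 2)) →
    ∀ ρ φ : ℝ, ρ ∈ Set.Ioo (a ^ 2 / 2) (b ^ 2 / 2) → φ ∈ Set.Ioo 0 π →
      pd1 (pd1 V) (ρ, φ) + ((m : ℝ) / ρ) * pd1 V (ρ, φ) +
        (((m : ℝ) - 1) / ρ ^ 2) * (Real.cos φ / Real.sin φ) * pd2 V (ρ, φ) +
        (1 / ρ ^ 2) * pd2 (pd2 V) (ρ, φ) + f (V (ρ, φ)) / (2 * ρ) = 0 := by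
  rintro V rfl ρ φ hρ hφ
  have key : ∀ q : ℝ × ℝ, q ∈ Set.Ioo (a ^ 2 / 2) (b ^ 2 / 2) ×ˢ Set.Ioo 0 π →
      0 < q.1 ∧ (Real.sqrt (2 * q.1), q.2 / 2) ∈ Set.Ioo a b ×ˢ Set.Ioo 0 (π / 2) := by
    rintro ⟨x, y⟩ ⟨⟨h1, h2⟩, h3, h4⟩
    simp only at h1 h2 h3 h4
    have hx : 0 < x := lt_trans (by positivity) h1
    refine ⟨hx, ⟨?_, ?_⟩, ?_, ?_⟩ <;> simp only
    · apply Real.lt_sqrt_of_sq_lt; linarith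
    · rw [Real.sqrt_lt' (by linarith)]; linarith
    · linarith
    · linarith
  have hop : IsOpen (Set.Ioo a b ×ˢ Set.Ioo 0 (π / 2)) := isOpen_Ioo.prod isOpen_Ioo
  have hop' : IsOpen (Set.Ioo (a ^ 2 / 2) (b ^ 2 / 2) ×ˢ Set.Ioo 0 π) :=
    isOpen_Ioo.prod isOpen_Ioo
  have hd : ∀ p ∈ Set.Ioo a b ×ˢ Set.Ioo 0 (π / 2), DifferentiableAt ℝ U p := fun p hp =>
    (hU.contDiffAt (hop.mem_nhds hp)).differentiableAt (by norm_num)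
  have hdd : ∀ p ∈ Set.Ioo a b ×ˢ Set.Ioo 0 (π / 2), DifferentiableAt ℝ (fderiv ℝ U) p :=
    fun p hp => ((hU.contDiffAt (hop.mem_nhds hp)).fderiv_right (m := 1)
      (by norm_num)).differentiableAt (by norm_num)
  have hd1 : ∀ p ∈ Set.Ioo a b ×ˢ Set.Ioo 0 (π / 2), DifferentiableAt ℝ (pd1 U) p :=
    fun p hp => (hdd p hp).clm_apply (differentiableAt_const _)
  have hd2 : ∀ p ∈ Set.Ioo a b ×ˢ Set.Ioo 0 (π / 2), DifferentiableAt ℝ (pd2 U) p :=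
    fun p hp => (hdd p hp).clm_apply (differentiableAt_const _)
  have hmem : ((ρ, φ) : ℝ × ℝ) ∈ Set.Ioo (a ^ 2 / 2) (b ^ 2 / 2) ×ˢ Set.Ioo 0 π := ⟨hρ, hφ⟩
  obtain ⟨hρ0, hp⟩ := key _ hmem
  simp only at hρ0 hp
  have e1 := pd1_comp U (ρ, φ) hρ0 (hd _ hp)
  have e2 := pd2_comp U (ρ, φ) hρ0 (hd _ hp)
  have e11 : pd1 (pd1 (fun q : ℝ × ℝ => U (Real.sqrt (2 * q.1), q.2 / 2))) (ρ, φ) =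
      (1 / (2 * ρ)) * pd1 (pd1 U) (Real.sqrt (2 * ρ), φ / 2)
       - 1 / (2 * ρ * Real.sqrt (2 * ρ)) * pd1 U (Real.sqrt (2 * ρ), φ / 2) := by
    have hev : pd1 (fun q : ℝ × ℝ => U (Real.sqrt (2 * q.1), q.2 / 2)) =ᶠ[nhds (ρ, φ)]
        fun q => (fun p : ℝ × ℝ => (1 / p.1) * pd1 U p) (Real.sqrt (2 * q.1), q.2 / 2) := by
      filter_upwards [hop'.mem_nhds hmem] with q hq
      obtain ⟨h1, h2⟩ := key q hq
      exact pd1_comp U q h1 (hd _ h2)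
    have hs : Real.sqrt (2 * ρ) ≠ 0 := by positivity
    have hss : Real.sqrt (2 * ρ) ^ 2 = 2 * ρ := Real.sq_sqrt (by positivity)
    have hi : HasFDerivAt (fun p : ℝ × ℝ => 1 / p.1)
        ((-((Real.sqrt (2 * ρ)) ^ 2)⁻¹) • ContinuousLinearMap.fst ℝ ℝ ℝ)
        (Real.sqrt (2 * ρ), φ / 2) := by
      simp only [one_div]
      exact (hasDerivAt_inv hs).comp_hasFDerivAt
        (f := fun p : ℝ × ℝ => p.1) (Real.sqrt (2 * ρ), φ / 2) hasFDerivAt_fst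
    have hm' : HasFDerivAt (fun p : ℝ × ℝ => (1 / p.1) * pd1 U p) _ _ :=
      hi.mul (hd1 _ hp).hasFDerivAt
    have h3 : pd1 (pd1 (fun q : ℝ × ℝ => U (Real.sqrt (2 * q.1), q.2 / 2))) (ρ, φ) =
      pd1 (fun q => (fun p : ℝ × ℝ => (1 / p.1) * pd1 U p) (Real.sqrt (2 * q.1), q.2 / 2))
        (ρ, φ) := by
      rw [pd1, hev.fderiv_eq]; rfl
    rw [h3, pd1_comp (fun p : ℝ × ℝ => (1 / p.1) * pd1 U p) (ρ, φ) hρ0 hm'.differentiableAt]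
    have h4 : pd1 (fun p : ℝ × ℝ => (1 / p.1) * pd1 U p) (Real.sqrt (2 * ρ), φ / 2) =
        (1 / Real.sqrt (2 * ρ)) * pd1 (pd1 U) (Real.sqrt (2 * ρ), φ / 2) -
        (1 / Real.sqrt (2 * ρ) ^ 2) * pd1 U (Real.sqrt (2 * ρ), φ / 2) := by
      rw [pd1, HasFDerivAt.fderiv hm']
      simp [pd1]
      ring
    simp only
    rw [h4, ← hss]
    simp only [Real.sqrt_sq (Real.sqrt_nonneg _)]
    field_simp
  have e22 : pd2 (pd2 (fun q : ℝ × ℝ => U (Real.sqrt (2 * q.1), q.2 / 2))) (ρ, φ) =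
      (1 / 4) * pd2 (pd2 U) (Real.sqrt (2 * ρ), φ / 2) := by
    have hev : pd2 (fun q : ℝ × ℝ => U (Real.sqrt (2 * q.1), q.2 / 2)) =ᶠ[nhds (ρ, φ)]
        fun q => (fun p : ℝ × ℝ => (1 / 2) * pd2 U p) (Real.sqrt (2 * q.1), q.2 / 2) := by
      filter_upwards [hop'.mem_nhds hmem] with q hq
      obtain ⟨h1, h2⟩ := key q hq
      exact pd2_comp U q h1 (hd _ h2)
    have hm' := (hd2 _ hp).hasFDerivAt.const_mul (1 / 2 : ℝ)
    have h3 : pd2 (pd2 (fun q : ℝ × ℝ => U (Real.sqrt (2 * q.1), q.2 / 2))) (ρ, φ) =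
      pd2 (fun q => (fun p : ℝ × ℝ => (1 / 2) * pd2 U p) (Real.sqrt (2 * q.1), q.2 / 2))
        (ρ, φ) := by
      rw [pd2, hev.fderiv_eq]; rfl
    rw [h3, pd2_comp (fun p : ℝ × ℝ => (1 / 2) * pd2 U p) (ρ, φ) hρ0 hm'.differentiableAt]
    have h4 : pd2 (fun p : ℝ × ℝ => (1 / 2) * pd2 U p) (Real.sqrt (2 * ρ), φ / 2) =
        (1 / 2) * pd2 (pd2 U) (Real.sqrt (2 * ρ), φ / 2) := by
      rw [pd2, HasFDerivAt.fderiv hm']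
      simp [pd2]
    simp only
    rw [h4]
    ring
  rw [e11, e22, e1, e2]
  have hE := hEq _ _ hp.1 hp.2
  simp only at hE ⊢
  have hc : Real.cos φ / Real.sin φ = (1 / 2) * (Real.cos (φ / 2) / Real.sin (φ / 2) -
      Real.sin (φ / 2) / Real.cos (φ / 2)) := by
    have hsn : Real.sin (φ / 2) ≠ 0 :=
      (Real.sin_pos_of_pos_of_lt_pi (by linarith [hφ.1]) (by linarith [hφ.1, hφ.2])).ne'
    have hcs : Real.cos (φ / 2) ≠ 0 :=
      (Real.cos_pos_of_mem_Ioo ⟨by linarith [hφ.1, hφ.2], by linarith [hφ.2]⟩).ne'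
    have hφ2 : φ = 2 * (φ / 2) := by ring
    have hcc : Real.cos φ = Real.cos (φ / 2) ^ 2 - Real.sin (φ / 2) ^ 2 := by
      conv_lhs => rw [hφ2]
      exact Real.cos_two_mul' _
    have hsc : Real.sin φ = 2 * Real.sin (φ / 2) * Real.cos (φ / 2) := by
      conv_lhs => rw [hφ2]
      exact Real.sin_two_mul _
    rw [hcc, hsc]
    field_simp
  rw [hc]
  generalize Real.cos (φ / 2) / Real.sin (φ / 2) - Real.sin (φ / 2) / Real.cos (φ / 2) = K at *
  have hs : Real.sqrt (2 * ρ) ≠ 0 := by positivity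
  have hss : ρ = Real.sqrt (2 * ρ) ^ 2 / 2 := by rw [Real.sq_sqrt (by positivity)]; ring
  generalize pd1 (pd1 U) (Real.sqrt (2 * ρ), φ / 2) = A at *
  generalize pd1 U (Real.sqrt (2 * ρ), φ / 2) = B at *
  generalize pd2 (pd2 U) (Real.sqrt (2 * ρ), φ / 2) = C at *
  generalize pd2 U (Real.sqrt (2 * ρ), φ / 2) = D at *
  generalize f (U (Real.sqrt (2 * ρ), φ / 2)) = F at *
  clear e1 e2 e11 e22 hp
  generalize Real.sqrt (2 * ρ) = r at *
  have hF : F = -(A + (2 * (m : ℝ) - 1) / r * B + ((m : ℝ) - 1) / r ^ 2 * K * D +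
      1 / r ^ 2 * C) := by linarith
  rw [hF, hss]
  field_simp
  ring
end
end

section
/- Let m ≥ 2, 0 < a < b, and let f : ℝ → ℝ be continuously differentiable. Let u ∈ C²(Ā) be O(m)×O(m)-invariant, satisfy −Δu = f(u) in A and u = 0 on ∂A. Define v : D̄ → ℝ by v(z',t) := u(√(|z|+t)·e₁, √(|z|−t)·e₁), where z = (z',t) ∈ ℝ^m × ℝ, |z| = √(|z'|²+t²), and e₁ ∈ ℝ^m is the first standard basis vector. Then v is twice continuously differentiable in D, axially symmetric about the axis e_{m+1}, and satisfies −Δv(z) = f(v(z))/(2|z|) for all z ∈ D and v = 0 on ∂D. -/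
noncomputable section
open Real

/-- Euclidean norm on `ℝ^m × ℝ^m = ℝ^{2m}`. -/
def pnorm {m : ℕ} (x : EuclideanSpace ℝ (Fin m) × EuclideanSpace ℝ (Fin m)) : ℝ :=
  Real.sqrt (‖x.1‖ ^ 2 + ‖x.2‖ ^ 2)

/-- The Euclidean Laplacian of a function on `ℝ^m × ℝ^m = ℝ^{2m}`. -/
def lapP {m : ℕ} (f : EuclideanSpace ℝ (Fin m) × EuclideanSpace ℝ (Fin m) → ℝ)
    (x : EuclideanSpace ℝ (Fin m) × EuclideanSpace ℝ (Fin m)) : ℝ :=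
  (∑ i : Fin m,
    fderiv ℝ (fun y => fderiv ℝ f y ((EuclideanSpace.single i (1 : ℝ)), 0)) x
      ((EuclideanSpace.single i (1 : ℝ)), 0)) +
  ∑ i : Fin m,
    fderiv ℝ (fun y => fderiv ℝ f y (0, (EuclideanSpace.single i (1 : ℝ)))) x
      (0, (EuclideanSpace.single i (1 : ℝ)))

/-- The annulus `A = {a < |x| < b}` in `ℝ^{2m} = ℝ^m × ℝ^m`. -/
def Ann (m : ℕ) (a b : ℝ) : Set (EuclideanSpace ℝ (Fin m) × EuclideanSpace ℝ (Fin m)) :=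
  {x | a < pnorm x ∧ pnorm x < b}

/-- Euclidean norm on `ℝ^m × ℝ = ℝ^{m+1}`. -/
def qnorm {m : ℕ} (z : EuclideanSpace ℝ (Fin m) × ℝ) : ℝ :=
  Real.sqrt (‖z.1‖ ^ 2 + z.2 ^ 2)

/-- The Euclidean Laplacian of a function on `ℝ^m × ℝ = ℝ^{m+1}`. -/
def lapQ {m : ℕ} (f : EuclideanSpace ℝ (Fin m) × ℝ → ℝ)
    (z : EuclideanSpace ℝ (Fin m) × ℝ) : ℝ :=
  (∑ i : Fin m,
    fderiv ℝ (fun y => fderiv ℝ f y ((EuclideanSpace.single i (1 : ℝ)), 0)) z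
      ((EuclideanSpace.single i (1 : ℝ)), 0)) +
  fderiv ℝ (fun y => fderiv ℝ f y (0, (1 : ℝ))) z (0, (1 : ℝ))

/-- The annulus `D = {a²/2 < |z| < b²/2}` in `ℝ^{m+1} = ℝ^m × ℝ`. -/
def AnnD (m : ℕ) (a b : ℝ) : Set (EuclideanSpace ℝ (Fin m) × ℝ) :=
  {z | a ^ 2 / 2 < qnorm z ∧ qnorm z < b ^ 2 / 2}


section helpers

set_option linter.unusedSimpArgs false
set_option linter.unusedVariables false

lemma deriv2_curve {E : Type*} [NormedAddCommGroup E] [NormedSpace ℝ E] (g : E → ℝ)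
    (γ γ' : ℝ → E) (p w q : E) (hp : γ 0 = p) (hw : γ' 0 = w)
    (hg : ContDiffAt ℝ 2 g p) (h1 : ∀ t, HasDerivAt γ (γ' t) t) (h2 : HasDerivAt γ' q 0) :
    deriv (deriv (fun t => g (γ t))) 0 = fderiv ℝ (fderiv ℝ g) p w w + fderiv ℝ g p q := by
  subst hp hw
  have hev : ∀ᶠ y in nhds (γ 0), ContDiffAt ℝ 2 g y := hg.eventually (by simp)
  have hev' := (h1 0).continuousAt.eventually hev
  have e1 : deriv (fun t => g (γ t)) =ᶠ[nhds 0] fun t => fderiv ℝ g (γ t) (γ' t) := by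
    filter_upwards [hev'] with t ht
    exact ((ht.differentiableAt (by norm_num)).hasFDerivAt.comp_hasDerivAt t (h1 t)).deriv
  rw [e1.deriv_eq]
  have hd : DifferentiableAt ℝ (fderiv ℝ g) (γ 0) :=
    (hg.fderiv_right (m := 1) (by norm_num)).differentiableAt (by norm_num)
  exact ((hd.hasFDerivAt.comp_hasDerivAt 0 (h1 0)).clm_apply h2).deriv

lemma fderiv_dir {E : Type*} [NormedAddCommGroup E] [NormedSpace ℝ E] (g : E → ℝ) (p e : E)
    (hg : ContDiffAt ℝ 2 g p) :
    fderiv ℝ (fun y => fderiv ℝ g y e) p e = fderiv ℝ (fderiv ℝ g) p e e := by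
  have hd : DifferentiableAt ℝ (fderiv ℝ g) p :=
    (hg.fderiv_right (m := 1) (by norm_num)).differentiableAt (by norm_num)
  have := (hd.hasFDerivAt.clm_apply (hasFDerivAt_const e p)).fderiv
  rw [this]; simp

/-- Rotation in the first factor. -/
lemma rot_identity {E F : Type*} [NormedAddCommGroup E] [InnerProductSpace ℝ E]
    [NormedAddCommGroup F] [NormedSpace ℝ F] (g : E × F → ℝ) (z p q : E) (y : F)
    (hg : ContDiffAt ℝ 2 g (z, y))
    (hsym : ∀ z' : E, ‖z'‖ = ‖z‖ → g (z', y) = g (z, y))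
    (h1 : inner ℝ p q = 0) (h2 : inner ℝ z p = 0) (h3 : inner ℝ z q = inner ℝ q q)
    (h4 : inner ℝ p p = inner ℝ q q) :
    fderiv ℝ (fderiv ℝ g) (z, y) (p, 0) (p, 0) = fderiv ℝ g (z, y) (q, 0) := by
  have hc : ∀ t : ℝ, ‖z + (Real.cos t - 1) • q + Real.sin t • p‖ = ‖z‖ := by
    intro t
    rw [← sq_eq_sq₀ (norm_nonneg _) (norm_nonneg _), ← real_inner_self_eq_norm_sq,
      ← real_inner_self_eq_norm_sq]
    simp only [inner_add_left, inner_add_right, inner_smul_left, inner_smul_right,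
      real_inner_comm z p, real_inner_comm z q, real_inner_comm p q, h1, h2, h3, h4]
    simp only [real_inner_self_eq_norm_sq, conj_trivial]
    linear_combination (‖q‖ ^ 2) * Real.sin_sq_add_cos_sq t
  have key := deriv2_curve g (fun t => (z + (Real.cos t - 1) • q + Real.sin t • p, y))
    (fun t => ((- Real.sin t) • q + Real.cos t • p, 0)) (z, y) (p, 0) (-q, 0)
    (by simp) (by simp) hg
    (fun t => by
      refine HasDerivAt.prodMk ?_ (hasDerivAt_const _ _)
      exact ((((Real.hasDerivAt_cos t).sub_const 1).smul_const q).const_add z).add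
        ((Real.hasDerivAt_sin t).smul_const p))
    (by
      refine HasDerivAt.prodMk ?_ (hasDerivAt_const _ _)
      have := ((Real.hasDerivAt_sin 0).neg.smul_const q).add
        ((Real.hasDerivAt_cos 0).smul_const p)
      simp only [Real.cos_zero, Real.sin_zero, neg_zero, zero_smul, add_zero, neg_one_smul] at this
      exact this)
  have hconst : (fun t : ℝ => g (z + (Real.cos t - 1) • q + Real.sin t • p, y))
      = fun _ => g (z, y) := by
    funext t; exact hsym _ (hc t)
  rw [hconst] at key
  have hneg : ((-q, 0) : E × F) = -(q, 0) := by simp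
  rw [hneg, map_neg] at key
  simp only [deriv_const', deriv_const] at key
  linarith

variable {m : ℕ}

local notation "EE" => EuclideanSpace ℝ (Fin m)
local notation "ee" i:max => (EuclideanSpace.single i (1 : ℝ))

lemma sum_single (z : EuclideanSpace ℝ (Fin m)) : z = ∑ j, z j • ee j := by
  ext i
  simp [Finset.sum_apply, Pi.single_apply]

lemma nsq (z : EuclideanSpace ℝ (Fin m)) : ‖z‖ ^ 2 = ∑ j, z j ^ 2 := by
  rw [EuclideanSpace.norm_sq_eq]; simp

lemma sum_pair (z : EuclideanSpace ℝ (Fin m)) : ((z, 0) : EE × ℝ) = ∑ j, z j • ((ee j, 0) : EE × ℝ) := by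
  refine Prod.ext ?_ ?_
  · simpa [Prod.fst_sum] using sum_single z
  · simp [Prod.snd_sum]

lemma lin_expand (d : EE × ℝ →L[ℝ] ℝ) (z : EuclideanSpace ℝ (Fin m)) :
    d (z, 0) = ∑ j, z j * d (ee j, 0) := by
  rw [sum_pair z, map_sum]
  simp only [map_smul, smul_eq_mul]

lemma bil_expand (B : EE × ℝ →L[ℝ] EE × ℝ →L[ℝ] ℝ) (z : EuclideanSpace ℝ (Fin m)) :
    B (z, 0) (z, 0) = ∑ j, ∑ k, z j * z k * B (ee j, 0) (ee k, 0) := by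
  rw [lin_expand (B (z, 0))]
  have : ∀ k, B (z, 0) (ee k, 0) = ∑ j, z j * B (ee j, 0) (ee k, 0) := by
    intro k
    exact lin_expand (B.flip (ee k, 0)) z
  simp_rw [this, Finset.mul_sum]
  rw [Finset.sum_comm]
  refine Finset.sum_congr rfl fun j _ => Finset.sum_congr rfl fun k _ => ?_
  ring

/-- Radial identity. -/
lemma radial_identity (v : EE × ℝ → ℝ) (z : EuclideanSpace ℝ (Fin m)) (t : ℝ)
    (hv : ContDiffAt ℝ 2 v (z, t))
    (hsym : ∀ z' : EuclideanSpace ℝ (Fin m), ‖z'‖ = ‖z‖ → v (z', t) = v (z, t)) :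
    ‖z‖ ^ 2 * ∑ j, fderiv ℝ (fderiv ℝ v) (z, t) (ee j, 0) (ee j, 0)
      = fderiv ℝ (fderiv ℝ v) (z, t) (z, 0) (z, 0) + (m - 1) * fderiv ℝ v (z, t) (z, 0) := by
  set B := fderiv ℝ (fderiv ℝ v) (z, t) with hB
  set d := fderiv ℝ v (z, t) with hd
  have hjk : ∀ j k : Fin m, z j ^ 2 * B (ee k, 0) (ee k, 0) + z k ^ 2 * B (ee j, 0) (ee j, 0)
      - z j * z k * B (ee j, 0) (ee k, 0) - z k * z j * B (ee k, 0) (ee j, 0)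
      = z j * d (ee j, 0) + z k * d (ee k, 0) - if j = k then 2 * (z j * d (ee j, 0)) else 0 := by
    intro j k
    by_cases h : j = k
    · subst h; simp; ring
    · rw [if_neg h]
      have hr := rot_identity v z (z j • ee k - z k • ee j) (z j • ee j + z k • ee k) t hv hsym
        (by simp only [inner_add_left, inner_add_right, inner_sub_left, inner_sub_right, inner_smul_left, inner_smul_right, EuclideanSpace.inner_single_left, EuclideanSpace.inner_single_right]; simp [h, Ne.symm h]; try ring)
        (by simp only [inner_add_left, inner_add_right, inner_sub_left, inner_sub_right, inner_smul_left, inner_smul_right, EuclideanSpace.inner_single_left, EuclideanSpace.inner_single_right]; simp [h, Ne.symm h]; try ring)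
        (by simp only [inner_add_left, inner_add_right, inner_sub_left, inner_sub_right, inner_smul_left, inner_smul_right, EuclideanSpace.inner_single_left, EuclideanSpace.inner_single_right]; simp [h, Ne.symm h]; try ring)
        (by simp only [inner_add_left, inner_add_right, inner_sub_left, inner_sub_right, inner_smul_left, inner_smul_right, EuclideanSpace.inner_single_left, EuclideanSpace.inner_single_right]; simp [h, Ne.symm h]; try ring)
      have e1 : ((z j • ee k - z k • ee j, 0) : EE × ℝ) = z j • (ee k, 0) - z k • (ee j, 0) := by
        simp
      have e2 : ((z j • ee j + z k • ee k, 0) : EE × ℝ) = z j • (ee j, 0) + z k • (ee k, 0) := by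
        simp
      rw [e1, e2, ← hB, ← hd] at hr
      simp only [map_sub, map_add, map_smul, sub_apply,
        smul_apply, smul_eq_mul] at hr
      linarith
  have hs : ∑ j, ∑ k, (z j ^ 2 * B (ee k, 0) (ee k, 0) + z k ^ 2 * B (ee j, 0) (ee j, 0)
      - z j * z k * B (ee j, 0) (ee k, 0) - z k * z j * B (ee k, 0) (ee j, 0))
      = ∑ j, ∑ k, (z j * d (ee j, 0) + z k * d (ee k, 0) - if j = k then 2 * (z j * d (ee j, 0)) else 0) :=
    Finset.sum_congr rfl fun j _ => Finset.sum_congr rfl fun k _ => hjk j k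
  simp only [Finset.sum_sub_distrib, Finset.sum_add_distrib] at hs
  have s1 : ∑ j, ∑ k, z j ^ 2 * B (ee k, 0) (ee k, 0) = ‖z‖ ^ 2 * ∑ j, B (ee j, 0) (ee j, 0) := by
    rw [nsq, Finset.sum_mul_sum]
  have s2 : ∑ j, ∑ k, z k ^ 2 * B (ee j, 0) (ee j, 0) = ‖z‖ ^ 2 * ∑ j, B (ee j, 0) (ee j, 0) := by
    rw [Finset.sum_comm, s1]
  have s4 : ∑ j, ∑ k, z k * z j * B (ee k, 0) (ee j, 0) = B (z, 0) (z, 0) := by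
    rw [Finset.sum_comm, bil_expand B z]
  rw [s1, s2, s4, ← bil_expand B z] at hs
  simp only [Finset.sum_ite_eq, Finset.mem_univ, if_true, Finset.sum_const, Finset.card_univ,
    Fintype.card_fin, ← Finset.mul_sum, ← lin_expand d z, nsmul_eq_mul] at hs
  linarith

lemma qnorm_phi (s : ℝ) (y : EuclideanSpace ℝ (Fin m)) :
    qnorm ((s • y, (s ^ 2 - ‖y‖ ^ 2) / 2) : EE × ℝ) = (s ^ 2 + ‖y‖ ^ 2) / 2 := by
  unfold qnorm
  rw [Real.sqrt_eq_iff_mul_self_eq (by positivity) (by positivity)]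
  simp only [norm_smul, mul_pow, Real.norm_eq_abs, sq_abs]
  ring

lemma deriv2_eq {E F : Type*} [NormedAddCommGroup E] [NormedSpace ℝ E]
    [NormedAddCommGroup F] [NormedSpace ℝ F] (g : E → ℝ) (k : F → ℝ)
    (γ γ' : ℝ → E) (δ δ' : ℝ → F) (p w q : E) (p₂ w₂ q₂ : F)
    (hp : γ 0 = p) (hw : γ' 0 = w)
    (hg : ContDiffAt ℝ 2 g p) (h1 : ∀ t, HasDerivAt γ (γ' t) t) (h2 : HasDerivAt γ' q 0)
    (hp₂ : δ 0 = p₂) (hw₂ : δ' 0 = w₂)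
    (hk : ContDiffAt ℝ 2 k p₂) (h1₂ : ∀ t, HasDerivAt δ (δ' t) t) (h2₂ : HasDerivAt δ' q₂ 0)
    (he : (fun t => g (γ t)) =ᶠ[nhds 0] fun t => k (δ t)) :
    fderiv ℝ (fderiv ℝ g) p w w + fderiv ℝ g p q =
      fderiv ℝ (fderiv ℝ k) p₂ w₂ w₂ + fderiv ℝ k p₂ q₂ ∧
    fderiv ℝ g p w = fderiv ℝ k p₂ w₂ := by
  constructor
  · rw [← deriv2_curve g γ γ' p w q hp hw hg h1 h2,
      ← deriv2_curve k δ δ' p₂ w₂ q₂ hp₂ hw₂ hk h1₂ h2₂]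
    exact he.deriv.deriv_eq
  · subst hp hw hp₂ hw₂
    have a1 := ((hg.differentiableAt (by norm_num)).hasFDerivAt.comp_hasDerivAt 0 (h1 0)).deriv
    have a2 := ((hk.differentiableAt (by norm_num)).hasFDerivAt.comp_hasDerivAt 0 (h1₂ 0)).deriv
    rw [← a1, ← a2]
    exact he.deriv_eq

lemma lap_relation (u : EE × EE → ℝ) (v : EE × ℝ → ℝ) (i₀ : Fin m) (s : ℝ) (hs : 0 < s)
    (y : EuclideanSpace ℝ (Fin m))
    (hv : ContDiffAt ℝ 2 v (s • y, (s ^ 2 - ‖y‖ ^ 2) / 2))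
    (hu : ContDiffAt ℝ 2 u (s • ee i₀, y))
    (hvsym : ∀ (z z' : EE) (t : ℝ), ‖z‖ = ‖z'‖ → v (z, t) = v (z', t))
    (husym : ∀ y₁ : EE, ‖y₁‖ = s → u (y₁, y) = u (s • ee i₀, y))
    (huv : ∀ᶠ x in nhds ((s • ee i₀, y) : EE × EE),
      u x = v (‖x.1‖ • x.2, (‖x.1‖ ^ 2 - ‖x.2‖ ^ 2) / 2)) :
    lapP u (s • ee i₀, y) = (s ^ 2 + ‖y‖ ^ 2) * lapQ v (s • y, (s ^ 2 - ‖y‖ ^ 2) / 2) := by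
  have hns : ‖(s • ee i₀ : EE)‖ = s := by
    rw [norm_smul]; simp [abs_of_pos hs]
  unfold lapP lapQ
  simp only [fderiv_dir u _ _ hu, fderiv_dir v _ _ hv]
  have hrad := radial_identity v (s • y) _ hv (fun z' h => hvsym _ _ _ h)
  -- direction (0, e_j)
  have hA : ∀ j : Fin m, fderiv ℝ (fderiv ℝ u) (s • ee i₀, y) (0, ee j) (0, ee j) =
      fderiv ℝ (fderiv ℝ v) (s • y, (s ^ 2 - ‖y‖ ^ 2) / 2) (s • ee j, -y j) (s • ee j, -y j)
        + fderiv ℝ v (s • y, (s ^ 2 - ‖y‖ ^ 2) / 2) (0, -1) := by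
    intro j
    have hcurve : ∀ t : ℝ, HasDerivAt (fun t : ℝ => ((s • ee i₀, y + t • ee j) : EE × EE)) (0, ee j) t := by
      intro t
      refine HasDerivAt.prodMk (hasDerivAt_const _ _) ?_
      simpa using ((hasDerivAt_id t).smul_const (ee j : EE)).const_add y
    have := (deriv2_eq u v (fun t : ℝ => (s • ee i₀, y + t • ee j)) (fun _ => (0, ee j))
      (fun t : ℝ => (s • (y + t • ee j), (s ^ 2 - ‖y‖ ^ 2 - 2 * t * y j - t ^ 2) / 2))
      (fun t : ℝ => (s • ee j, - y j - t)) (s • ee i₀, y) (0, ee j) 0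
      (s • y, (s ^ 2 - ‖y‖ ^ 2) / 2) (s • ee j, -y j) (0, -1) (by simp) rfl hu hcurve
      (hasDerivAt_const _ _) (by simp) (by simp) hv
      (by
        intro t
        refine HasDerivAt.prodMk ?_ ?_
        · have h := (((hasDerivAt_id t).smul_const (ee j : EE)).const_add y).const_smul s
          rw [one_smul] at h
          exact h
        · have h := (((((hasDerivAt_id t).const_mul 2).mul_const (y j)).const_sub (s ^ 2 - ‖y‖ ^ 2)).sub
            ((hasDerivAt_id t).pow 2)).div_const 2
          refine h.congr_deriv ?_
          simp; ring)
      (by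
        refine HasDerivAt.prodMk (hasDerivAt_const _ _) ?_
        exact (hasDerivAt_id (0:ℝ)).const_sub (- y j))
      (by
        have hc := (hcurve 0).continuousAt
        have hc' : Filter.Tendsto (fun t : ℝ => ((s • ee i₀, y + t • ee j) : EE × EE)) (nhds 0)
          (nhds (s • ee i₀, y)) := by simpa [ContinuousAt] using hc
        filter_upwards [hc'.eventually huv] with t ht
        rw [ht, hns]
        congr 2
        rw [← real_inner_self_eq_norm_sq, ← real_inner_self_eq_norm_sq]
        simp only [inner_add_left, inner_add_right, inner_smul_left, inner_smul_right,
          EuclideanSpace.inner_single_left, EuclideanSpace.inner_single_right]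
        simp
        ring)).1
    simpa using this
  have hB : fderiv ℝ (fderiv ℝ u) (s • ee i₀, y) (ee i₀, 0) (ee i₀, 0) =
      fderiv ℝ (fderiv ℝ v) (s • y, (s ^ 2 - ‖y‖ ^ 2) / 2) (y, s) (y, s)
        + fderiv ℝ v (s • y, (s ^ 2 - ‖y‖ ^ 2) / 2) (0, 1) ∧
      fderiv ℝ u (s • ee i₀, y) (ee i₀, 0) = fderiv ℝ v (s • y, (s ^ 2 - ‖y‖ ^ 2) / 2) (y, s) := by
    have hcurve : ∀ t : ℝ, HasDerivAt (fun t : ℝ => (((s + t) • ee i₀, y) : EE × EE)) (ee i₀, 0) t := by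
      intro t
      refine HasDerivAt.prodMk ?_ (hasDerivAt_const _ _)
      simpa using ((hasDerivAt_id t).const_add s).smul_const (ee i₀ : EE)
    have := (deriv2_eq u v (fun t : ℝ => ((s + t) • ee i₀, y)) (fun _ => (ee i₀, 0))
      (fun t : ℝ => ((s + t) • y, ((s + t) ^ 2 - ‖y‖ ^ 2) / 2))
      (fun t : ℝ => (y, s + t)) (s • ee i₀, y) (ee i₀, 0) 0
      (s • y, (s ^ 2 - ‖y‖ ^ 2) / 2) (y, s) (0, 1) (by simp) rfl hu hcurve
      (hasDerivAt_const _ _) (by simp) (by simp) hv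
      (by
        intro t
        refine HasDerivAt.prodMk ?_ ?_
        · simpa using ((hasDerivAt_id t).const_add s).smul_const y
        · have h := ((((hasDerivAt_id t).const_add s).pow 2).sub_const (‖y‖ ^ 2)).div_const 2
          refine h.congr_deriv ?_
          simp)
      (by
        refine HasDerivAt.prodMk (hasDerivAt_const _ _) ?_
        exact (hasDerivAt_id (0:ℝ)).const_add s)
      (by
        have hc := (hcurve 0).continuousAt
        have hc' : Filter.Tendsto (fun t : ℝ => (((s + t) • ee i₀, y) : EE × EE)) (nhds 0)
          (nhds (s • ee i₀, y)) := by simpa [ContinuousAt] using hc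
        filter_upwards [hc'.eventually huv, eventually_gt_nhds (neg_lt_zero.2 hs)] with t ht ht2
        have : ‖((s + t) • ee i₀ : EE)‖ = s + t := by
          rw [norm_smul]; simp [abs_of_pos (show 0 < s + t by linarith)]
        rw [ht, this]))
    simpa using this
  have hC : ∀ k : Fin m, k ≠ i₀ → fderiv ℝ (fderiv ℝ u) (s • ee i₀, y) (ee k, 0) (ee k, 0) =
      s⁻¹ * fderiv ℝ v (s • y, (s ^ 2 - ‖y‖ ^ 2) / 2) (y, s) := by
    intro k hk
    have h := rot_identity u (s • ee i₀) (s • ee k) (s • ee i₀) y hu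
      (fun z' hz' => husym z' (by rw [hz', hns]))
      (by simp only [inner_smul_left, inner_smul_right, EuclideanSpace.inner_single_left]; simp [hk, hk.symm])
      (by simp only [inner_smul_left, inner_smul_right, EuclideanSpace.inner_single_left]; simp [hk, hk.symm]) rfl
      (by simp [inner_smul_left, inner_smul_right, norm_smul])
    have e1 : ((s • ee k, 0) : EE × EE) = s • (ee k, 0) := by simp
    have e2 : ((s • ee i₀, 0) : EE × EE) = s • (ee i₀, 0) := by simp
    rw [e1, e2] at h
    simp only [map_smul, smul_apply, smul_eq_mul] at h
    rw [← hB.2]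
    field_simp
    exact mul_left_cancel₀ hs.ne' (by linarith)
  set B := fderiv ℝ (fderiv ℝ v) (s • y, (s ^ 2 - ‖y‖ ^ 2) / 2)
  set d := fderiv ℝ v (s • y, (s ^ 2 - ‖y‖ ^ 2) / 2)
  have hfirst : ∑ k, fderiv ℝ (fderiv ℝ u) (s • ee i₀, y) (ee k, 0) (ee k, 0)
      = B (y, s) (y, s) + d (0, 1) + (m - 1) * (s⁻¹ * d (y, s)) := by
    have : ∀ k : Fin m, fderiv ℝ (fderiv ℝ u) (s • ee i₀, y) (ee k, 0) (ee k, 0) =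
        s⁻¹ * d (y, s) + if k = i₀ then (B (y, s) (y, s) + d (0, 1) - s⁻¹ * d (y, s)) else 0 := by
      intro k
      by_cases hk : k = i₀
      · subst hk; rw [hB.1]; simp
      · rw [hC k hk]; simp [hk]
    simp_rw [this]
    rw [Finset.sum_add_distrib]
    simp
    ring
  have hd : d (y, s) = d (y, 0) + s * d (0, 1) := by
    have : ((y, s) : EE × ℝ) = (y, 0) + s • (0, 1) := by simp
    rw [this, map_add, map_smul]; simp
  have hd1 : d (0, -1) = - d (0, 1) := by
    rw [← map_neg]; simp
  have hBy : B (y, s) (y, s) = B (y, 0) (y, 0) + s * B (y, 0) (0, 1) + s * B (0, 1) (y, 0)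
      + s ^ 2 * B (0, 1) (0, 1) := by
    have : ((y, s) : EE × ℝ) = (y, 0) + s • (0, 1) := by simp
    rw [this]
    simp only [map_add, map_smul, add_apply, smul_apply, smul_eq_mul]
    ring
  have hBj : ∀ j : Fin m, B (s • ee j, -y j) (s • ee j, -y j) = s ^ 2 * B (ee j, 0) (ee j, 0)
      - s * (y j * B (ee j, 0) (0, 1)) - s * (y j * B (0, 1) (ee j, 0))
      + y j ^ 2 * B (0, 1) (0, 1) := by
    intro j
    have : ((s • ee j, -y j) : EE × ℝ) = s • (ee j, 0) - y j • (0, 1) := by simp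
    rw [this]
    simp only [map_sub, map_smul, sub_apply, smul_apply, smul_eq_mul]
    ring
  have hsecond : ∑ j, fderiv ℝ (fderiv ℝ u) (s • ee i₀, y) (0, ee j) (0, ee j)
      = s ^ 2 * ∑ j, B (ee j, 0) (ee j, 0) - s * B (y, 0) (0, 1) - s * B (0, 1) (y, 0)
        + ‖y‖ ^ 2 * B (0, 1) (0, 1) - m * d (0, 1) := by
    have q1 : B (y, 0) (0, 1) = ∑ j, y j * B (ee j, 0) (0, 1) :=
      lin_expand (B.flip (0, 1)) y
    rw [q1, lin_expand (B (0, 1)) y, nsq]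
    simp_rw [hA, hBj]
    simp only [Finset.sum_add_distrib, Finset.sum_sub_distrib, Finset.mul_sum, Finset.sum_mul, hd1]
    simp
    ring
  have e3 : ((s • y, 0) : EE × ℝ) = s • (y, 0) := by simp
  rw [e3, norm_smul, mul_pow, Real.norm_eq_abs, sq_abs] at hrad
  simp only [map_smul, smul_apply, smul_eq_mul] at hrad
  have hrad' : ‖y‖ ^ 2 * ∑ j, B (ee j, 0) (ee j, 0) = B (y, 0) (y, 0) + (m - 1) * (s⁻¹ * d (y, 0)) := by
    have : s ^ 2 ≠ 0 := by positivity
    apply mul_left_cancel₀ this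
    have e : s ^ 2 * (s⁻¹ * d (y, 0)) = s * d (y, 0) := by field_simp
    linear_combination hrad - (m - 1) * e
  have e4 : s⁻¹ * (d (y, 0) + s * d (0, 1)) = s⁻¹ * d (y, 0) + d (0, 1) := by field_simp
  rw [hfirst, hsecond, hBy, hd, e4]
  linear_combination -hrad'

def vv (u : EE × EE → ℝ) (i₀ : Fin m) (z : EE × ℝ) : ℝ :=
  u (Real.sqrt (qnorm z + z.2) • EuclideanSpace.single i₀ (1 : ℝ),
    Real.sqrt (qnorm z - z.2) • EuclideanSpace.single i₀ (1 : ℝ))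

lemma qnorm_sq (z : EE × ℝ) : qnorm z ^ 2 = ‖z.1‖ ^ 2 + z.2 ^ 2 := by
  unfold qnorm
  exact Real.sq_sqrt (by positivity)

lemma abs_le_qnorm (z : EE × ℝ) : |z.2| ≤ qnorm z := by
  unfold qnorm
  apply Real.abs_le_sqrt
  nlinarith [sq_nonneg ‖z.1‖]

lemma qnorm_continuous : Continuous (qnorm : EE × ℝ → ℝ) := by
  unfold qnorm
  fun_prop

lemma pnorm_continuous : Continuous (pnorm : EE × EE → ℝ) := by
  unfold pnorm
  fun_prop

lemma isOpen_Ann (a b : ℝ) : IsOpen (Ann m a b) :=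
  (isOpen_lt continuous_const pnorm_continuous).inter (isOpen_lt pnorm_continuous continuous_const)

lemma isOpen_AnnD (a b : ℝ) : IsOpen (AnnD m a b) :=
  (isOpen_lt continuous_const qnorm_continuous).inter (isOpen_lt qnorm_continuous continuous_const)

lemma norm_smul_single (i₀ : Fin m) (s : ℝ) (hs : 0 ≤ s) :
    ‖(s • EuclideanSpace.single i₀ (1 : ℝ) : EE)‖ = s := by
  rw [norm_smul]; simp [abs_of_nonneg hs]

lemma pnorm_of (z : EE × ℝ) (x₁ x₂ : EE) (h1 : ‖x₁‖ = Real.sqrt (qnorm z + z.2))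
    (h2 : ‖x₂‖ = Real.sqrt (qnorm z - z.2)) : pnorm (x₁, x₂) = Real.sqrt (2 * qnorm z) := by
  have h := abs_le.1 (abs_le_qnorm z)
  unfold pnorm
  simp only
  rw [h1, h2, Real.sq_sqrt (by linarith), Real.sq_sqrt (by linarith)]
  ring_nf

lemma mem_Ann_of (a b : ℝ) (ha : 0 < a) (hab : a < b) (z : EE × ℝ) (hz : z ∈ AnnD m a b)
    (x₁ x₂ : EE) (h1 : ‖x₁‖ = Real.sqrt (qnorm z + z.2))
    (h2 : ‖x₂‖ = Real.sqrt (qnorm z - z.2)) : (x₁, x₂) ∈ Ann m a b := by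
  obtain ⟨p, q⟩ := hz
  refine ⟨?_, ?_⟩
  · rw [pnorm_of z x₁ x₂ h1 h2]
    exact Real.lt_sqrt_of_sq_lt (by linarith)
  · rw [pnorm_of z x₁ x₂ h1 h2, Real.sqrt_lt' (by linarith)]
    linarith

lemma half (a b : ℝ) (ha : 0 < a) (hab : a < b) (f : ℝ → ℝ)
    (u : EE × EE → ℝ) (i₀ : Fin m) (hu : ∀ x ∈ Ann m a b, ContDiffAt ℝ 2 u x)
    (hinv : ∀ x ∈ Ann m a b, ∀ x' ∈ Ann m a b, ‖x.1‖ = ‖x'.1‖ → ‖x.2‖ = ‖x'.2‖ → u x = u x')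
    (heq : ∀ x ∈ Ann m a b, -lapP u x = f (u x))
    (z : EE × ℝ) (hz : z ∈ AnnD m a b) (hpos : 0 < qnorm z + z.2) :
    ContDiffAt ℝ 2 (vv u i₀) z ∧ -lapQ (vv u i₀) z = f (vv u i₀ z) / (2 * qnorm z) := by
  have hinv' : ∀ x₁ x₂ y₁ y₂ : EE, (x₁, x₂) ∈ Ann m a b → (y₁, y₂) ∈ Ann m a b →
      ‖x₁‖ = ‖y₁‖ → ‖x₂‖ = ‖y₂‖ → u (x₁, x₂) = u (y₁, y₂) :=
    fun x₁ x₂ y₁ y₂ h1 h2 h3 h4 => hinv _ h1 _ h2 h3 h4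
  have hnorm : ∀ w : EE × ℝ, 0 < qnorm w + w.2 →
      ‖(Real.sqrt (qnorm w + w.2))⁻¹ • w.1‖ = Real.sqrt (qnorm w - w.2) := by
    intro w hw
    have h := abs_le.1 (abs_le_qnorm w)
    have hs : 0 < Real.sqrt (qnorm w + w.2) := Real.sqrt_pos.2 hw
    rw [norm_smul, norm_inv, Real.norm_of_nonneg hs.le]
    rw [inv_mul_eq_iff_eq_mul₀ hs.ne', ← Real.sqrt_mul hw.le]
    symm
    rw [Real.sqrt_eq_iff_mul_self_eq (by nlinarith) (norm_nonneg _)]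
    have := qnorm_sq w
    nlinarith
  have hvG : ∀ w ∈ AnnD m a b, 0 < qnorm w + w.2 →
      vv u i₀ w = u (Real.sqrt (qnorm w + w.2) • EuclideanSpace.single i₀ (1 : ℝ),
        (Real.sqrt (qnorm w + w.2))⁻¹ • w.1) := by
    intro w hw hwp
    have n1 := norm_smul_single i₀ _ (Real.sqrt_nonneg (qnorm w + w.2))
    have n2 := norm_smul_single i₀ _ (Real.sqrt_nonneg (qnorm w - w.2))
    exact hinv' _ _ _ _ (mem_Ann_of a b ha hab w hw _ _ n1 n2)
      (mem_Ann_of a b ha hab w hw _ _ n1 (hnorm w hwp)) rfl (n2.trans (hnorm w hwp).symm)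
  have hxA : (Real.sqrt (qnorm z + z.2) • EuclideanSpace.single i₀ (1 : ℝ),
        (Real.sqrt (qnorm z + z.2))⁻¹ • z.1) ∈ Ann m a b :=
    mem_Ann_of a b ha hab z hz _ _ (norm_smul_single i₀ _ (Real.sqrt_nonneg _)) (hnorm z hpos)
  have hq : 0 < qnorm z := lt_trans (by positivity) hz.1
  have hC : ContDiffAt ℝ 2 (vv u i₀) z := by
    have hev : vv u i₀ =ᶠ[nhds z] fun w => u (Real.sqrt (qnorm w + w.2) • EuclideanSpace.single i₀ (1 : ℝ),
        (Real.sqrt (qnorm w + w.2))⁻¹ • w.1) := by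
      have o1 := (isOpen_AnnD a b).mem_nhds hz
      have o2 : ∀ᶠ w in nhds z, 0 < qnorm w + w.2 :=
        (qnorm_continuous.add continuous_snd).continuousAt.eventually (lt_mem_nhds hpos)
      filter_upwards [o1, o2] with w h1 h2
      exact hvG w h1 h2
    refine ContDiffAt.congr_of_eventuallyEq ?_ hev
    have cq : ContDiffAt ℝ 2 (qnorm : EE × ℝ → ℝ) z := by
      unfold qnorm
      refine ContDiffAt.sqrt ?_ ?_
      · exact ((contDiffAt_fst.norm_sq ℝ).add (contDiffAt_snd.pow 2))
      · rw [← qnorm_sq]; positivity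
    have cs : ContDiffAt ℝ 2 (fun w : EE × ℝ => Real.sqrt (qnorm w + w.2)) z :=
      (cq.add contDiffAt_snd).sqrt hpos.ne'
    have hsp : Real.sqrt (qnorm z + z.2) ≠ 0 := (Real.sqrt_pos.2 hpos).ne'
    exact ContDiffAt.comp z (hu _ hxA)
      ((cs.smul contDiffAt_const).prodMk ((cs.inv hsp).smul contDiffAt_fst))
  refine ⟨hC, ?_⟩
  set s := Real.sqrt (qnorm z + z.2) with hs
  have hsp : 0 < s := Real.sqrt_pos.2 hpos
  set y : EE := s⁻¹ • z.1 with hy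
  have hab' := abs_le.1 (abs_le_qnorm z)
  have hs2 : s ^ 2 = qnorm z + z.2 := Real.sq_sqrt hpos.le
  have hy2 : ‖y‖ ^ 2 = qnorm z - z.2 := by
    rw [hy, hnorm z hpos, Real.sq_sqrt (by linarith)]
  have hz1 : z = (s • y, (s ^ 2 - ‖y‖ ^ 2) / 2) := by
    refine Prod.ext ?_ ?_
    · simp [hy, smul_smul, hsp.ne']
    · rw [hs2, hy2]; ring
  have hrel := lap_relation u (vv u i₀) i₀ s hsp y (hz1 ▸ hC) (hu _ hxA)
    (by
      intro p p' t hpp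
      unfold vv qnorm
      simp only [hpp])
    (by
      intro y₁ hy₁
      have : ‖(s • EuclideanSpace.single i₀ (1 : ℝ) : EE)‖ = s := norm_smul_single i₀ s hsp.le
      exact hinv' _ _ _ _ (mem_Ann_of a b ha hab z hz _ _ hy₁ (hnorm z hpos)) hxA (hy₁.trans this.symm) rfl)
    (by
      filter_upwards [(isOpen_Ann a b).mem_nhds hxA] with x hx
      unfold vv
      have e1 : (‖x.1‖ ^ 2 + ‖‖x.2‖‖ ^ 2) / 2 + (‖x.1‖ ^ 2 - ‖x.2‖ ^ 2) / 2 = ‖x.1‖ ^ 2 := by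
        simp; ring
      have e2 : (‖x.1‖ ^ 2 + ‖‖x.2‖‖ ^ 2) / 2 - (‖x.1‖ ^ 2 - ‖x.2‖ ^ 2) / 2 = ‖x.2‖ ^ 2 := by
        simp; ring
      rw [norm_norm] at e1 e2
      simp only [qnorm_phi, e1, e2, Real.sqrt_sq (norm_nonneg _)]
      have n1 := norm_smul_single i₀ ‖x.1‖ (norm_nonneg _)
      have n2 := norm_smul_single i₀ ‖x.2‖ (norm_nonneg _)
      refine hinv' x.1 x.2 _ _ hx ?_ n1.symm n2.symm
      have : pnorm ((‖x.1‖ • EuclideanSpace.single i₀ (1 : ℝ), ‖x.2‖ • EuclideanSpace.single i₀ (1 : ℝ)) : EE × EE)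
          = pnorm x := by
        unfold pnorm
        simp only [n1, n2]
      unfold Ann at hx ⊢
      simp only [Set.mem_ofPred_eq, this]
      exact hx)
  rw [← hz1] at hrel
  have h0 := heq _ hxA
  rw [hrel, hs2, hy2, ← hvG z hz hpos] at h0
  rw [← h0]
  field_simp
  ring

lemma lapP_swap (u : EE × EE → ℝ) (x : EE × EE) : lapP (fun w => u w.swap) x = lapP u x.swap := by
  have key : ∀ (g : EE × EE → ℝ) (p e : EE × EE),
      fderiv ℝ (fun w => g w.swap) p e = fderiv ℝ g p.swap e.swap := by
    intro g p e
    have := (ContinuousLinearEquiv.prodComm ℝ EE EE).comp_right_fderiv (f := g) (x := p)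
    have h2 : (g ∘ (ContinuousLinearEquiv.prodComm ℝ EE EE)) = fun w => g w.swap := rfl
    rw [h2] at this
    rw [this]; rfl
  unfold lapP
  simp only [key]
  have key2 : ∀ (c p e : EE × EE), fderiv ℝ (fun w => fderiv ℝ u w.swap c) p e
      = fderiv ℝ (fun w => fderiv ℝ u w c) p.swap e.swap :=
    fun c p e => key (fun w => fderiv ℝ u w c) p e
  simp only [key2, Prod.swap_prod_mk]
  rw [add_comm]

def refl2 (m : ℕ) : (EuclideanSpace ℝ (Fin m) × ℝ) ≃L[ℝ] (EuclideanSpace ℝ (Fin m) × ℝ) :=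
  (ContinuousLinearEquiv.refl ℝ _).prodCongr (ContinuousLinearEquiv.neg ℝ)

lemma lapQ_refl (v : EE × ℝ → ℝ) (x : EE × ℝ) :
    lapQ (fun w => v (w.1, -w.2)) x = lapQ v (x.1, -x.2) := by
  have key : ∀ (g : EE × ℝ → ℝ) (p e : EE × ℝ),
      fderiv ℝ (fun w => g (w.1, -w.2)) p e = fderiv ℝ g (p.1, -p.2) (e.1, -e.2) := by
    intro g p e
    have := (refl2 m).comp_right_fderiv (f := g) (x := p)
    have h2 : (g ∘ (refl2 m)) = fun w => g (w.1, -w.2) := rfl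
    rw [h2] at this
    rw [this]; rfl
  unfold lapQ
  simp only [key]
  have key2 : ∀ (c p e : EE × ℝ), fderiv ℝ (fun w : EE × ℝ => fderiv ℝ v (w.1, -w.2) c) p e
      = fderiv ℝ (fun w => fderiv ℝ v w c) (p.1, -p.2) (e.1, -e.2) :=
    fun c p e => key (fun w => fderiv ℝ v w c) p e
  have e1 : ((0, -1) : EE × ℝ) = -(0, 1) := by simp
  simp only [key2, neg_zero, e1, map_neg]
  have : (fun y : EE × ℝ => -(fderiv ℝ v (y.1, -y.2)) (0, 1))
      = -(fun y : EE × ℝ => (fderiv ℝ v (y.1, -y.2)) (0, 1)) := rfl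
  rw [this, fderiv_neg]
  simp only [neg_apply, key2, e1, map_neg, neg_neg]

lemma full (a b : ℝ) (ha : 0 < a) (hab : a < b) (f : ℝ → ℝ)
    (u : EE × EE → ℝ) (i₀ : Fin m) (hu : ∀ x ∈ Ann m a b, ContDiffAt ℝ 2 u x)
    (hinv : ∀ x ∈ Ann m a b, ∀ x' ∈ Ann m a b, ‖x.1‖ = ‖x'.1‖ → ‖x.2‖ = ‖x'.2‖ → u x = u x')
    (heq : ∀ x ∈ Ann m a b, -lapP u x = f (u x))
    (z : EE × ℝ) (hz : z ∈ AnnD m a b) :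
    ContDiffAt ℝ 2 (vv u i₀) z ∧ -lapQ (vv u i₀) z = f (vv u i₀ z) / (2 * qnorm z) := by
  by_cases hpos : 0 < qnorm z + z.2
  · exact half a b ha hab f u i₀ hu hinv heq z hz hpos
  have hq : 0 < qnorm z := lt_trans (by positivity) hz.1
  have hsw : ∀ x : EE × EE, x ∈ Ann m a b → x.swap ∈ Ann m a b := by
    intro x hx
    have : pnorm x.swap = pnorm x := by
      unfold pnorm; simp [add_comm]
    unfold Ann at hx ⊢
    simp only [Set.mem_ofPred_eq, this]
    exact hx
  have hqr : ∀ w : EE × ℝ, qnorm (w.1, -w.2) = qnorm w := by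
    intro w; unfold qnorm; simp
  have hz' : (z.1, -z.2) ∈ AnnD m a b := by
    unfold AnnD at hz ⊢
    simp only [Set.mem_ofPred_eq, hqr]
    exact hz
  have hvv : ∀ w : EE × ℝ, vv (fun x => u x.swap) i₀ w = vv u i₀ (w.1, -w.2) := by
    intro w
    unfold vv
    simp only [hqr, Prod.swap_prod_mk, sub_neg_eq_add, ← sub_eq_add_neg]
  have hvv' : vv (fun x => u x.swap) i₀ = fun w => vv u i₀ (w.1, -w.2) := funext hvv
  obtain ⟨h1, h2⟩ := half a b ha hab f (fun x => u x.swap) i₀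
    (fun x hx => ContDiffAt.comp x (hu _ (hsw x hx)) (contDiff_snd.prodMk contDiff_fst).contDiffAt)
    (fun x hx x' hx' e1 e2 => hinv _ (hsw x hx) _ (hsw x' hx') e2 e1)
    (fun x hx => by rw [lapP_swap]; exact heq _ (hsw x hx))
    (z.1, -z.2) hz' (by rw [hqr]; simp only; linarith)
  rw [hqr, hvv, hvv', lapQ_refl] at h2
  rw [hvv'] at h1
  simp only [neg_neg, Prod.mk.eta] at h2
  refine ⟨?_, h2⟩
  have h3 := ContDiffAt.comp (f := fun w : EE × ℝ => (w.1, -w.2)) z h1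
    (contDiff_fst.prodMk contDiff_snd.neg).contDiffAt
  refine h3.congr_of_eventuallyEq (Filter.Eventually.of_forall fun w => ?_)
  simp

lemma pnorm_smul (c : ℝ) (hc : 0 ≤ c) (x : EE × EE) : pnorm (c • x) = c * pnorm x := by
  unfold pnorm
  simp only [Prod.smul_fst, Prod.smul_snd, norm_smul, mul_pow, Real.norm_of_nonneg hc]
  rw [← mul_add, Real.sqrt_mul (by positivity), Real.sqrt_sq hc]

lemma mem_frontier_Ann (a b : ℝ) (ha : 0 < a) (hab : a < b) (x : EE × EE)
    (hx : pnorm x = a ∨ pnorm x = b) : x ∈ frontier (Ann m a b) := by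
  rw [(isOpen_Ann a b).frontier_eq]
  have hcont : Continuous (fun c : ℝ => c • x) := by fun_prop
  refine ⟨?_, ?_⟩
  · have hcl : ∀ s : Set ℝ, (∀ c ∈ s, c • x ∈ Ann m a b) → (1 : ℝ) ∈ closure s →
        x ∈ closure (Ann m a b) := by
      intro s hs h1
      have := map_mem_closure hcont h1 (fun c hc => hs c hc)
      simpa using this
    have hb : 0 < b := ha.trans hab
    rcases hx with hx | hx
    · have h1 : 1 < b / a := by rwa [one_lt_div ha]
      refine hcl (Set.Ioo 1 (b / a)) ?_ ?_
      · intro c hc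
        have : pnorm (c • x) = c * a := by rw [pnorm_smul c (by linarith [hc.1]), hx]
        have h3 := (lt_div_iff₀ ha).1 hc.2
        refine ⟨?_, ?_⟩ <;> rw [this]
        · nlinarith [hc.1]
        · exact h3
      · rw [closure_Ioo h1.ne]; exact ⟨le_rfl, h1.le⟩
    · have h1 : a / b < 1 := by rwa [div_lt_one hb]
      refine hcl (Set.Ioo (a / b) 1) ?_ ?_
      · intro c hc
        have h0 : 0 < a / b := by positivity
        have : pnorm (c • x) = c * b := by rw [pnorm_smul c (by linarith [hc.1]), hx]
        have h3 := (div_lt_iff₀ hb).1 hc.1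
        refine ⟨?_, ?_⟩ <;> rw [this]
        · exact h3
        · nlinarith [hc.2]
      · rw [closure_Ioo h1.ne]; exact ⟨h1.le, le_rfl⟩
  · rintro ⟨h1, h2⟩
    rcases hx with hx | hx <;> rw [hx] at h1 h2
    · exact lt_irrefl _ h1
    · exact lt_irrefl _ h2

lemma frontier_AnnD (a b : ℝ) (z : EE × ℝ) (hz : z ∈ frontier (AnnD m a b)) :
    qnorm z = a ^ 2 / 2 ∨ qnorm z = b ^ 2 / 2 := by
  rw [(isOpen_AnnD a b).frontier_eq] at hz
  obtain ⟨h1, h2⟩ := hz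
  have hc : IsClosed {w : EE × ℝ | a ^ 2 / 2 ≤ qnorm w ∧ qnorm w ≤ b ^ 2 / 2} :=
    (isClosed_le continuous_const qnorm_continuous).inter
      (isClosed_le qnorm_continuous continuous_const)
  have h3 : z ∈ {w : EE × ℝ | a ^ 2 / 2 ≤ qnorm w ∧ qnorm w ≤ b ^ 2 / 2} :=
    closure_minimal (fun w (hw : a ^ 2 / 2 < qnorm w ∧ qnorm w < b ^ 2 / 2) => And.intro hw.1.le hw.2.le) hc h1
  by_contra hcon
  push Not at hcon
  exact h2 ⟨lt_of_le_of_ne h3.1 (Ne.symm hcon.1), lt_of_le_of_ne h3.2 hcon.2⟩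

end helpers

/-- the reduction from the Dirichlet problem `−Δu = f(u)` on the annulus
`A ⊂ ℝ^{2m}` for `O(m)×O(m)`-invariant `u ∈ C²(Ā)` to the Dirichlet problem
`−Δv = f(v)/(2|z|)` on the annulus `D ⊂ ℝ^{m+1}` for the axially symmetric function
`v(z',t) := u(√(|z|+t)·e₁, √(|z|−t)·e₁)`. -/
theorem stmt_5 (m : ℕ) (hm : 2 ≤ m) (a b : ℝ) (ha : 0 < a) (hab : a < b)
    (f : ℝ → ℝ) (hf : ContDiff ℝ 1 f)
    (u : EuclideanSpace ℝ (Fin m) × EuclideanSpace ℝ (Fin m) → ℝ)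
    (hreg : ContDiffOn ℝ 2 u (closure (Ann m a b)))
    (hinv : ∀ x ∈ closure (Ann m a b), ∀ x' ∈ closure (Ann m a b),
      ‖x.1‖ = ‖x'.1‖ → ‖x.2‖ = ‖x'.2‖ → u x = u x')
    (heq : ∀ x ∈ Ann m a b, -lapP u x = f (u x))
    (hbd : ∀ x ∈ frontier (Ann m a b), u x = 0) :
    ∀ v : EuclideanSpace ℝ (Fin m) × ℝ → ℝ,
      v = (fun z => u (Real.sqrt (qnorm z + z.2) • EuclideanSpace.single (⟨0, by omega⟩ : Fin m) (1 : ℝ),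
        Real.sqrt (qnorm z - z.2) • EuclideanSpace.single (⟨0, by omega⟩ : Fin m) (1 : ℝ))) →
      ContDiffOn ℝ 2 v (AnnD m a b) ∧
      (∀ z ∈ closure (AnnD m a b), ∀ w ∈ closure (AnnD m a b),
        ‖z.1‖ = ‖w.1‖ → z.2 = w.2 → v z = v w) ∧
      (∀ z ∈ AnnD m a b, -lapQ v z = f (v z) / (2 * qnorm z)) ∧
      (∀ z ∈ frontier (AnnD m a b), v z = 0) := by
  rintro v rfl
  have hu : ∀ x ∈ Ann m a b, ContDiffAt ℝ 2 u x := fun x hx =>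
    hreg.contDiffAt (Filter.mem_of_superset ((isOpen_Ann a b).mem_nhds hx) subset_closure)
  have hfull := full a b ha hab f u (⟨0, by omega⟩ : Fin m) hu
    (fun x hx x' hx' => hinv x (subset_closure hx) x' (subset_closure hx')) heq
  refine ⟨fun z hz => (hfull z hz).1.contDiffWithinAt, ?_, fun z hz => (hfull z hz).2, ?_⟩
  · intro z _ w _ h1 h2
    simp only [qnorm, h1, h2]
  · intro z hz
    apply hbd
    apply mem_frontier_Ann a b ha hab
    rw [pnorm_of z _ _ (norm_smul_single _ _ (Real.sqrt_nonneg _))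
      (norm_smul_single _ _ (Real.sqrt_nonneg _))]
    rcases frontier_AnnD a b z hz with h | h
    · left
      rw [h, show 2 * (a ^ 2 / 2) = a ^ 2 by ring, Real.sqrt_sq ha.le]
    · right
      rw [h, show 2 * (b ^ 2 / 2) = b ^ 2 by ring, Real.sqrt_sq (ha.trans hab).le]
end
end
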